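/- arXiv:2502.05839 — 4 statements merged into one kernel-verified Lean document; each statement's English description precedes it below -/
import Mathlib

section
/- The function g satisfies g(0) = 0 and g'(x) > 0 for every x ∈ ℝ; in particular g is strictly increasing on ℝ. -/
open Real Set Filter

/-- Gluing two differentiable functions that agree to first order at `a`. -/
theorem hasDerivAt_ite_lt {a : ℝ} {f₁ f₂ f₁' f₂' : ℝ → ℝ}
    (h₁ : ∀ x, HasDerivAt f₁ (f₁' x) x) (h₂ : ∀ x, HasDerivAt f₂ (f₂' x) x)
    (hf : f₁ a = f₂ a) (hf' : f₁' a = f₂' a) (x : ℝ) :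
    HasDerivAt (fun y => if a < y then f₂ y else f₁ y) (if a < x then f₂' x else f₁' x) x := by
  rcases lt_trichotomy x a with hx | rfl | hx
  · rw [if_neg hx.not_gt]
    refine (h₁ x).congr_of_eventuallyEq ?_
    filter_upwards [Iio_mem_nhds hx] with y hy
    exact if_neg (not_lt.mpr (le_of_lt hy))
  · rw [if_neg (lt_irrefl x)]
    have hl : HasDerivWithinAt (fun y => if x < y then f₂ y else f₁ y) (f₁' x) (Iic x) x :=
      (h₁ x).hasDerivWithinAt.congr (fun y hy => if_neg (not_lt.mpr hy)) (if_neg (lt_irrefl x))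
    have hr : HasDerivWithinAt (fun y => if x < y then f₂ y else f₁ y) (f₁' x) (Ici x) x := by
      rw [hf']
      refine (h₂ x).hasDerivWithinAt.congr (fun y hy => ?_) ?_
      · rcases eq_or_lt_of_le (show x ≤ y from hy) with rfl | h
        · simpa using hf
        · exact if_pos h
      · simpa using hf
    have h := hl.union hr
    rwa [Iic_union_Ici, hasDerivWithinAt_univ] at h
  · rw [if_pos hx]
    refine (h₂ x).congr_of_eventuallyEq ?_
    filter_upwards [Ioi_mem_nhds hx] with y hy
    exact if_pos hy

theorem abs_lt_sqrt_sq_add (m : ℝ) {q s : ℝ} (hq : 0 < q) (hs : 0 < s) :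
    |m| < Real.sqrt (m ^ 2 + 2 * q * s ^ 2) := by
  rw [← Real.sqrt_sq_eq_abs]
  exact Real.sqrt_lt_sqrt (sq_nonneg m) (by nlinarith [mul_pos hq (pow_pos hs 2)])

theorem hasDerivAt_exp_mul_sub (k a x : ℝ) :
    HasDerivAt (fun y => Real.exp (k * (y - a))) (k * Real.exp (k * (x - a))) x := by
  have h := (((hasDerivAt_id x).sub_const a).const_mul k).exp
  simpa [mul_comm] using h

theorem statement0
    (a q μp μm σp σm : ℝ)
    (ha : 0 < a) (hq : 0 < q) (hσp : 0 < σp) (hσm : 0 < σm)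
    (θ1p θ2p θ1m θ2m cm cp : ℝ)
    (hθ1p : θ1p = (Real.sqrt (μp ^ 2 + 2 * q * σp ^ 2) + μp) / σp ^ 2)
    (hθ2p : θ2p = (Real.sqrt (μp ^ 2 + 2 * q * σp ^ 2) - μp) / σp ^ 2)
    (hθ1m : θ1m = (Real.sqrt (μm ^ 2 + 2 * q * σm ^ 2) + μm) / σm ^ 2)
    (hθ2m : θ2m = (Real.sqrt (μm ^ 2 + 2 * q * σm ^ 2) - μm) / σm ^ 2)
    (hcm : cm = (θ1m - θ1p) / (θ2m + θ1m))
    (hcp : cp = (θ2p - θ2m) / (θ2p + θ1p))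
    (gm gp g : ℝ → ℝ)
    (hgm : ∀ x, gm x = if a < x then Real.exp (-θ1p * (x - a))
      else cm * Real.exp (θ2m * (x - a)) + (1 - cm) * Real.exp (-θ1m * (x - a)))
    (hgp : ∀ x, gp x = if a < x then (1 - cp) * Real.exp (θ2p * (x - a)) + cp * Real.exp (-θ1p * (x - a))
      else Real.exp (θ2m * (x - a)))
    (hg : ∀ x, g x = gp x * gm 0 - gm x * gp 0)
    :
    g 0 = 0 ∧ (∀ x : ℝ, 0 < deriv g x) ∧ StrictMono g := by
  have hmp := abs_lt.mp (abs_lt_sqrt_sq_add μp hq hσp)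
  have hmm := abs_lt.mp (abs_lt_sqrt_sq_add μm hq hσm)
  have h1p : 0 < θ1p := hθ1p ▸ div_pos (by linarith) (by positivity)
  have h2p : 0 < θ2p := hθ2p ▸ div_pos (by linarith) (by positivity)
  have h1m : 0 < θ1m := hθ1m ▸ div_pos (by linarith) (by positivity)
  have h2m : 0 < θ2m := hθ2m ▸ div_pos (by linarith) (by positivity)
  clear hθ1p hθ2p hθ1m hθ2m
  have hcm_eq : cm * (θ2m + θ1m) = θ1m - θ1p := by rw [hcm]; field_simp
  have hcp_eq : cp * (θ2p + θ1p) = θ2p - θ2m := by rw [hcp]; field_simp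
  have hcm_pos : 0 < 1 - cm := by
    have h : 0 < (1 - cm) * (θ2m + θ1m) := by linarith
    exact pos_of_mul_pos_left h (by linarith)
  have hcp_pos : 0 < 1 - cp := by
    have h : 0 < (1 - cp) * (θ2p + θ1p) := by linarith
    exact pos_of_mul_pos_left h (by linarith)
  have hgm0 : gm 0 = cm * Real.exp (θ2m * (0 - a)) + (1 - cm) * Real.exp (-θ1m * (0 - a)) := by
    rw [hgm, if_neg ha.not_gt]
  have hgp0 : gp 0 = Real.exp (θ2m * (0 - a)) := by
    rw [hgp, if_neg ha.not_gt]
  have hgp0_pos : 0 < gp 0 := hgp0 ▸ Real.exp_pos _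
  have hgm0_pos : 0 < gm 0 := by
    have hle : Real.exp (θ2m * (0 - a)) ≤ Real.exp (-θ1m * (0 - a)) :=
      Real.exp_le_exp.mpr (by nlinarith [mul_pos h2m ha, mul_pos h1m ha])
    have := mul_le_mul_of_nonneg_left hle hcm_pos.le
    rw [hgm0]
    linarith [Real.exp_pos (θ2m * (0 - a))]
  have hdm : ∀ x, HasDerivAt gm (if a < x then -θ1p * Real.exp (-θ1p * (x - a))
      else cm * (θ2m * Real.exp (θ2m * (x - a)))
        + (1 - cm) * (-θ1m * Real.exp (-θ1m * (x - a)))) x := by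
    rw [funext hgm]
    refine hasDerivAt_ite_lt
      (f₁' := fun x => cm * (θ2m * Real.exp (θ2m * (x - a)))
        + (1 - cm) * (-θ1m * Real.exp (-θ1m * (x - a))))
      (f₂' := fun x => -θ1p * Real.exp (-θ1p * (x - a)))
      (fun x => ((hasDerivAt_exp_mul_sub _ a x).const_mul _).add
        ((hasDerivAt_exp_mul_sub _ a x).const_mul _))
      (fun x => hasDerivAt_exp_mul_sub _ a x) ?_ ?_
    · simp
    · simp only [sub_self, mul_zero, Real.exp_zero]
      linarith
  have hdp : ∀ x, HasDerivAt gp (if a < x then (1 - cp) * (θ2p * Real.exp (θ2p * (x - a)))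
        + cp * (-θ1p * Real.exp (-θ1p * (x - a)))
      else θ2m * Real.exp (θ2m * (x - a))) x := by
    rw [funext hgp]
    refine hasDerivAt_ite_lt
      (f₁' := fun x => θ2m * Real.exp (θ2m * (x - a)))
      (f₂' := fun x => (1 - cp) * (θ2p * Real.exp (θ2p * (x - a)))
        + cp * (-θ1p * Real.exp (-θ1p * (x - a))))
      (fun x => hasDerivAt_exp_mul_sub _ a x)
      (fun x => ((hasDerivAt_exp_mul_sub _ a x).const_mul _).add
        ((hasDerivAt_exp_mul_sub _ a x).const_mul _)) ?_ ?_
    · simp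
    · simp only [sub_self, mul_zero, Real.exp_zero]
      linarith
  have hderiv : ∀ x, 0 < deriv g x := by
    intro x
    rw [funext hg, (((hdp x).mul_const (gm 0)).fun_sub ((hdm x).mul_const (gp 0))).deriv]
    split_ifs with hx
    · have hu : 0 < x - a := sub_pos.mpr hx
      have hle : Real.exp (-θ1p * (x - a)) ≤ Real.exp (θ2p * (x - a)) :=
        Real.exp_le_exp.mpr (by nlinarith [mul_pos h1p hu, mul_pos h2p hu])
      have hE := Real.exp_pos (-θ1p * (x - a))
      have hgp_pos : 0 < (1 - cp) * (θ2p * Real.exp (θ2p * (x - a)))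
          + cp * (-θ1p * Real.exp (-θ1p * (x - a))) := by
        have h := mul_le_mul_of_nonneg_left hle (mul_pos hcp_pos h2p).le
        have hpos := mul_pos h2m hE
        have heq : θ2m = (1 - cp) * θ2p - cp * θ1p := by linarith
        rw [heq] at hpos
        linarith
      have h₁ := mul_pos hgp_pos hgm0_pos
      have h₂ := mul_pos (mul_pos h1p hE) hgp0_pos
      linarith
    · rw [hgm0, hgp0]
      have h₁ := mul_pos hcm_pos (mul_pos h2m
        (mul_pos (Real.exp_pos (θ2m * (x - a))) (Real.exp_pos (-θ1m * (0 - a)))))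
      have h₂ := mul_pos hcm_pos (mul_pos h1m
        (mul_pos (Real.exp_pos (-θ1m * (x - a))) (Real.exp_pos (θ2m * (0 - a)))))
      linarith
  exact ⟨by rw [hg]; ring, hderiv, strictMono_of_deriv_pos hderiv⟩
end

section
/- The set M_ζ is nonempty, and there exists z₀ ∈ (0,∞) such that M_ζ ⊆ {(x,y) ∈ [0,∞)² : x + β < y < z₀}. -/
open Real Set Filter

lemma hasDerivAt_exp_add_exp (A B p r t : ℝ) :
    HasDerivAt (fun t => A * Real.exp (p * t) + B * Real.exp (-r * t))
      (A * p * Real.exp (p * t) - B * r * Real.exp (-r * t)) t := by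
  have h (c k : ℝ) : HasDerivAt (fun t => c * Real.exp (k * t)) (c * (Real.exp (k * t) * k)) t := by
    simpa using (((hasDerivAt_id t).const_mul k).exp).const_mul c
  exact ((h A p).add (h B (-r))).congr_deriv (by ring)

lemma strictMonoOn_exp_add_exp {A B p r : ℝ} (hA : 0 < A) (hp : 0 < p) (hr : 0 < r)
    (h : B * r ≤ A * p) :
    StrictMonoOn (fun t => A * Real.exp (p * t) + B * Real.exp (-r * t)) (Ici 0) := by
  refine strictMonoOn_of_deriv_pos (convex_Ici 0) (by fun_prop) fun t ht => ?_
  rw [interior_Ici, mem_Ioi] at ht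
  rw [(hasDerivAt_exp_add_exp A B p r t).deriv]
  have h1 : 1 < Real.exp (p * t) := Real.one_lt_exp_iff.2 (by positivity)
  have h2 : Real.exp (-r * t) ≤ 1 := Real.exp_le_one_iff.2 (by nlinarith)
  have h3 : 0 < Real.exp (-r * t) := Real.exp_pos _
  have hAp : 0 < A * p := by positivity
  nlinarith [mul_le_mul_of_nonneg_right h h3.le]

lemma exists_le_slope_exp_add_exp {A p r : ℝ} (B : ℝ) (hA : 0 < A) (hp : 0 < p) (hr : 0 < r)
    (K : ℝ) :
    ∃ N : ℝ, 0 ≤ N ∧ ∀ x y, N ≤ x → x ≤ y →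
      K * (y - x) ≤ (A * Real.exp (p * y) + B * Real.exp (-r * y)) -
        (A * Real.exp (p * x) + B * Real.exp (-r * x)) := by
  have hlim : Tendsto (fun t => A * p * Real.exp (p * t) - |B * r|) atTop atTop :=
    tendsto_atTop_add_const_right _ _ <| (Real.tendsto_exp_atTop.comp
      (tendsto_id.const_mul_atTop hp)).const_mul_atTop (mul_pos hA hp)
  obtain ⟨N, hN⟩ := eventually_atTop.1 ((tendsto_atTop.1 hlim K).and (eventually_ge_atTop 0))
  refine ⟨max N 0, le_max_right _ _, fun x y hx hxy => ?_⟩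
  refine (convex_Ici (max N 0)).mul_sub_le_image_sub_of_le_deriv
    (f := fun t => A * Real.exp (p * t) + B * Real.exp (-r * t)) (by fun_prop)
    (fun t _ => (hasDerivAt_exp_add_exp A B p r t).differentiableAt.differentiableWithinAt)
    (fun t ht => ?_) x hx y (hx.trans hxy) hxy
  rw [interior_Ici, mem_Ioi] at ht
  obtain ⟨h1, ht0⟩ := hN t ((le_max_left _ _).trans ht.le)
  rw [(hasDerivAt_exp_add_exp A B p r t).deriv]
  have h2 : Real.exp (-r * t) ≤ 1 := Real.exp_le_one_iff.2 (by nlinarith)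
  have h3 : 0 < Real.exp (-r * t) := Real.exp_pos _
  have h4 : B * r * Real.exp (-r * t) ≤ |B * r| :=
    (mul_le_mul_of_nonneg_right (le_abs_self _) h3.le).trans
      (mul_le_of_le_one_right (abs_nonneg _) h2)
  linarith

/-- A continuous strictly increasing function whose slope tends to infinity admits a maximiser of
`(y - x - β) / (g y - g x)`, and all maximisers lie strictly inside a bounded region. -/
lemma maximizers_nonempty_and_bounded {g : ℝ → ℝ} {β : ℝ} (hβ : 0 < β) (hcont : Continuous g)
    (hmono : StrictMono g)
    (hslope : ∀ K : ℝ, ∃ N, 0 ≤ N ∧ ∀ x y, N ≤ x → x ≤ y → K * (y - x) ≤ g y - g x)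
    {D : Set (ℝ × ℝ)} (hD : D = {p : ℝ × ℝ | 0 ≤ p.1 ∧ 0 ≤ p.2 ∧ p.1 + β ≤ p.2})
    {ζ : ℝ → ℝ → ℝ} (hζ : ∀ x y, ζ x y = (y - x - β) / (g y - g x)) :
    {p ∈ D | ∀ p' ∈ D, ζ p'.1 p'.2 ≤ ζ p.1 p.2}.Nonempty ∧ ∃ z₀ : ℝ, 0 < z₀ ∧
      {p ∈ D | ∀ p' ∈ D, ζ p'.1 p'.2 ≤ ζ p.1 p.2} ⊆
        {p : ℝ × ℝ | 0 ≤ p.1 ∧ 0 ≤ p.2 ∧ p.1 + β < p.2 ∧ p.2 < z₀} := by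
  set m := ζ 0 (2 * β) with hm
  have hmem : ((0 : ℝ), 2 * β) ∈ D := by
    rw [hD]
    exact ⟨le_rfl, by positivity, by dsimp only; linarith⟩
  have hm0 : 0 < m := by
    rw [hm, hζ]
    exact div_pos (by linarith) (sub_pos.2 (hmono (by linarith)))
  obtain ⟨N, hN0, hN⟩ := hslope (2 / m)
  set z₀ := 2 * N + 2 * β with hz₀
  have hz₀pos : 0 < z₀ := by positivity
  have hfar : ∀ p ∈ D, z₀ ≤ p.2 → ζ p.1 p.2 < m := by
    rintro ⟨x, y⟩ hp hy
    rw [hD] at hp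
    obtain ⟨hx0, hy0, hxy⟩ := hp
    dsimp only at hx0 hy0 hxy hy ⊢
    rw [hζ, div_lt_iff₀ (sub_pos.2 (hmono (by linarith)))]
    have hK : ∀ d : ℝ, m * (2 / m * d) = 2 * d := fun d => by field_simp
    rcases le_total (y / 2) x with h | h
    · have := mul_le_mul_of_nonneg_left (hN x y (by linarith) (by linarith)) hm0.le
      rw [hK] at this
      linarith
    · have := mul_le_mul_of_nonneg_left (hN (y / 2) y (by linarith) (by linarith)) hm0.le
      rw [hK] at this
      have := mul_le_mul_of_nonneg_left (hmono.monotone h) hm0.le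
      linarith
  refine ⟨?_, z₀, hz₀pos, ?_⟩
  · have hclosed : IsClosed D := by
      rw [hD]
      exact (isClosed_le continuous_const continuous_fst).inter
        ((isClosed_le continuous_const continuous_snd).inter
          (isClosed_le (continuous_fst.add continuous_const) continuous_snd))
    have hcomp : IsCompact (D ∩ Icc (0 : ℝ × ℝ) (z₀, z₀)) := isCompact_Icc.inter_left hclosed
    have hcontζ : ContinuousOn (fun p : ℝ × ℝ => ζ p.1 p.2) (D ∩ Icc (0 : ℝ × ℝ) (z₀, z₀)) := by
      simp only [hζ]
      refine ContinuousOn.div (by fun_prop) (by fun_prop) fun p hp => ?_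
      have hp := hp.1
      rw [hD] at hp
      exact (sub_pos.2 (hmono (by linarith [hp.2.2]))).ne'
    have hmem' : ((0 : ℝ), 2 * β) ∈ D ∩ Icc (0 : ℝ × ℝ) (z₀, z₀) :=
      ⟨hmem, ⟨le_rfl, by positivity⟩, ⟨hz₀pos.le, by dsimp only; linarith⟩⟩
    obtain ⟨p, hp, hmax⟩ := hcomp.exists_isMaxOn ⟨_, hmem'⟩ hcontζ
    refine ⟨p, hp.1, fun p' hp' => ?_⟩
    rcases le_total z₀ p'.2 with h | h
    · exact (hfar p' hp' h).le.trans (hmax hmem')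
    · refine hmax ⟨hp', ?_⟩
      rw [hD] at hp'
      obtain ⟨h1, h2, h3⟩ := hp'
      exact ⟨⟨h1, h2⟩, ⟨by dsimp only; linarith, h⟩⟩
  · rintro p ⟨hp, hmax⟩
    have hle : m ≤ ζ p.1 p.2 := hmax _ hmem
    have hlt : p.2 < z₀ := by
      by_contra! h
      exact (hfar p hp h).not_ge hle
    rw [hD] at hp
    obtain ⟨h1, h2, h3⟩ := hp
    refine ⟨h1, h2, lt_of_le_of_ne h3 fun h => ?_, hlt⟩
    have : ζ p.1 p.2 = 0 := by
      rw [hζ, ← h]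
      simp
    linarith

lemma sqrt_sq_add_div_pos {q σ : ℝ} (hq : 0 < q) (hσ : 0 < σ) (μ : ℝ) :
    0 < (Real.sqrt (μ ^ 2 + 2 * q * σ ^ 2) + μ) / σ ^ 2 ∧
      0 < (Real.sqrt (μ ^ 2 + 2 * q * σ ^ 2) - μ) / σ ^ 2 := by
  have h : |μ| < Real.sqrt (μ ^ 2 + 2 * q * σ ^ 2) := by
    apply Real.lt_sqrt_of_sq_lt
    rw [sq_abs]
    have : 0 < 2 * q * σ ^ 2 := by positivity
    linarith
  have := neg_abs_le μ
  have := le_abs_self μ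
  exact ⟨div_pos (by linarith) (by positivity), div_pos (by linarith) (by positivity)⟩

theorem statement1
    (a q μp μm σp σm : ℝ)
    (ha : 0 < a) (hq : 0 < q) (hσp : 0 < σp) (hσm : 0 < σm)
    (θ1p θ2p θ1m θ2m cm cp : ℝ)
    (hθ1p : θ1p = (Real.sqrt (μp ^ 2 + 2 * q * σp ^ 2) + μp) / σp ^ 2)
    (hθ2p : θ2p = (Real.sqrt (μp ^ 2 + 2 * q * σp ^ 2) - μp) / σp ^ 2)
    (hθ1m : θ1m = (Real.sqrt (μm ^ 2 + 2 * q * σm ^ 2) + μm) / σm ^ 2)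
    (hθ2m : θ2m = (Real.sqrt (μm ^ 2 + 2 * q * σm ^ 2) - μm) / σm ^ 2)
    (hcm : cm = (θ1m - θ1p) / (θ2m + θ1m))
    (hcp : cp = (θ2p - θ2m) / (θ2p + θ1p))
    (gm gp g : ℝ → ℝ)
    (hgm : ∀ x, gm x = if a < x then Real.exp (-θ1p * (x - a))
      else cm * Real.exp (θ2m * (x - a)) + (1 - cm) * Real.exp (-θ1m * (x - a)))
    (hgp : ∀ x, gp x = if a < x then (1 - cp) * Real.exp (θ2p * (x - a)) + cp * Real.exp (-θ1p * (x - a))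
      else Real.exp (θ2m * (x - a)))
    (hg : ∀ x, g x = gp x * gm 0 - gm x * gp 0)
    (β : ℝ) (hβ : 0 < β)
    (Dζ : Set (ℝ × ℝ))
    (hD : Dζ = {p : ℝ × ℝ | 0 ≤ p.1 ∧ 0 ≤ p.2 ∧ p.1 + β ≤ p.2})
    (ζ : ℝ → ℝ → ℝ)
    (hζ : ∀ z₁ z₂, ζ z₁ z₂ = (z₂ - z₁ - β) / (g z₂ - g z₁))
    (Mζ : Set (ℝ × ℝ))
    (hM : Mζ = {p ∈ Dζ | ∀ p' ∈ Dζ, ζ p'.1 p'.2 ≤ ζ p.1 p.2})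
    :
    Mζ.Nonempty ∧ ∃ z₀ : ℝ, 0 < z₀ ∧ Mζ ⊆ {p : ℝ × ℝ | 0 ≤ p.1 ∧ 0 ≤ p.2 ∧ p.1 + β < p.2 ∧ p.2 < z₀} := by
  obtain ⟨h1p, h2p⟩ := sqrt_sq_add_div_pos hq hσp μp
  obtain ⟨h1m, h2m⟩ := sqrt_sq_add_div_pos hq hσm μm
  rw [← hθ1p] at h1p
  rw [← hθ2p] at h2p
  rw [← hθ1m] at h1m
  rw [← hθ2m] at h2m
  have hcm' : cm * (θ2m + θ1m) = θ1m - θ1p := by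
    rw [hcm]
    exact div_mul_cancel₀ _ (by positivity)
  have hcp' : cp * (θ2p + θ1p) = θ2p - θ2m := by
    rw [hcp]
    exact div_mul_cancel₀ _ (by positivity)
  have hcm1 : 0 < 1 - cm := by
    have : 0 < (1 - cm) * (θ2m + θ1m) := by linarith
    exact pos_of_mul_pos_left this (by positivity)
  have hcp1 : 0 < 1 - cp := by
    have : 0 < (1 - cp) * (θ2p + θ1p) := by linarith
    exact pos_of_mul_pos_left this (by positivity)
  have hgp_ge : ∀ x, a ≤ x → gp x = (1 - cp) * Real.exp (θ2p * (x - a)) +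
      cp * Real.exp (-θ1p * (x - a)) := by
    intro x hx
    rcases hx.eq_or_lt with rfl | hx
    · simp [hgp]
    · rw [hgp, if_pos hx]
  have hgp_le : ∀ x, x ≤ a → gp x = Real.exp (θ2m * (x - a)) := fun x hx => by
    rw [hgp, if_neg hx.not_gt]
  have hgm_ge : ∀ x, a ≤ x → gm x = Real.exp (-θ1p * (x - a)) := by
    intro x hx
    rcases hx.eq_or_lt with rfl | hx
    · simp [hgm]
    · rw [hgm, if_pos hx]
  have hgm_le : ∀ x, x ≤ a → gm x = (1 - cm) * Real.exp (θ1m * (a - x)) +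
      cm * Real.exp (-θ2m * (a - x)) := fun x hx => by
    rw [hgm, if_neg hx.not_gt, add_comm]
    congr 3 <;> ring_nf
  have hgp_mono : StrictMono gp := by
    refine StrictMonoOn.Iic_union_Ici (a := a) (fun x hx y hy hxy => ?_) fun x hx y hy hxy => ?_
    · rw [hgp_le x hx, hgp_le y hy]
      gcongr
    · rw [hgp_ge x hx, hgp_ge y hy]
      exact strictMonoOn_exp_add_exp hcp1 h2p h1p (by linarith) (mem_Ici.2 (sub_nonneg.2 hx))
        (mem_Ici.2 (sub_nonneg.2 hy)) (by linarith)
  have hgm_anti : StrictAnti gm := by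
    refine StrictAntiOn.Iic_union_Ici (a := a) (fun x hx y hy hxy => ?_) fun x hx y hy hxy => ?_
    · rw [hgm_le x hx, hgm_le y hy]
      exact strictMonoOn_exp_add_exp hcm1 h1m h2m (by linarith) (mem_Ici.2 (sub_nonneg.2 hy))
        (mem_Ici.2 (sub_nonneg.2 hx)) (by linarith)
    · rw [hgm_ge x hx, hgm_ge y hy]
      exact Real.exp_lt_exp.2 (by nlinarith)
  have hgp_cont : Continuous gp := by
    rw [← continuousOn_univ, ← Iic_union_Ici (a := a)]
    refine ContinuousOn.union_of_isClosed ?_ ?_ isClosed_Iic isClosed_Ici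
    · exact ContinuousOn.congr (by fun_prop) hgp_le
    · exact ContinuousOn.congr (by fun_prop) hgp_ge
  have hgm_cont : Continuous gm := by
    rw [← continuousOn_univ, ← Iic_union_Ici (a := a)]
    refine ContinuousOn.union_of_isClosed ?_ ?_ isClosed_Iic isClosed_Ici
    · exact ContinuousOn.congr (by fun_prop) hgm_le
    · exact ContinuousOn.congr (by fun_prop) hgm_ge
  have hgp0 : 0 < gp 0 := by
    rw [hgp_le 0 ha.le]
    positivity
  have hgm0 : 0 < gm 0 := by
    have : gm a = 1 := by simp [hgm_ge a le_rfl]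
    linarith [hgm_anti ha]
  have hdiff : ∀ x y, g y - g x = gm 0 * (gp y - gp x) + gp 0 * (gm x - gm y) := fun x y => by
    rw [hg, hg]
    ring
  have hg_mono : StrictMono g := fun x y hxy => by
    have h1 := mul_pos hgm0 (sub_pos.2 (hgp_mono hxy))
    have h2 := mul_pos hgp0 (sub_pos.2 (hgm_anti hxy))
    linarith [hdiff x y]
  have hg_cont : Continuous g := by
    rw [funext hg]
    fun_prop
  rw [hM]
  refine maximizers_nonempty_and_bounded hβ hg_cont hg_mono (fun K => ?_) hD hζ
  obtain ⟨N, hN0, hN⟩ := exists_le_slope_exp_add_exp cp hcp1 h2p h1p (K / gm 0)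
  refine ⟨N + a, by positivity, fun x y hx hxy => ?_⟩
  have h1 := hN (x - a) (y - a) (by linarith) (by linarith)
  rw [← hgp_ge x (by linarith), ← hgp_ge y (by linarith), sub_sub_sub_cancel_right] at h1
  have h2 := mul_le_mul_of_nonneg_left h1 hgm0.le
  rw [← mul_assoc, mul_div_cancel₀ _ hgm0.ne'] at h2
  have h3 := mul_nonneg hgp0.le (sub_nonneg.2 (hgm_anti.antitone hxy))
  linarith [hdiff x y]
end

section
/- Every (z₁,z₂) ∈ M_ζ satisfies g(z₂) − g(z₁) = (z₂ − z₁ − β)·g'(z₂), equivalently ψ(z₁,z₂) = β; moreover, if in addition z₁ > 0, then also g(z₂) − g(z₁) = (z₂ − z₁ − β)·g'(z₁), and hence g'(z₁) = g'(z₂). -/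
open Real Set Filter

theorem hasDerivAt_ite_lt_s2 {u v u' v' : ℝ → ℝ} {a : ℝ} (hu : ∀ x, HasDerivAt u (u' x) x)
    (hv : ∀ x, HasDerivAt v (v' x) x) (h : u a = v a) (h' : u' a = v' a) (x : ℝ) :
    HasDerivAt (fun y => if a < y then u y else v y) (if a < x then u' x else v' x) x := by
  rcases lt_trichotomy x a with hx | rfl | hx
  · rw [if_neg hx.not_gt]
    refine (hv x).congr_of_eventuallyEq ?_
    filter_upwards [Iio_mem_nhds hx] with y hy
    exact if_neg (not_lt.2 (le_of_lt hy))
  · rw [if_neg (lt_irrefl x), ← hasDerivWithinAt_univ, ← Iic_union_Ici (a := x)]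
    refine HasDerivWithinAt.union ?_ ?_
    · refine (hv x).hasDerivWithinAt.congr (fun y hy => if_neg (not_lt.2 hy)) ?_
      exact if_neg (lt_irrefl x)
    · rw [← h']
      refine (hu x).hasDerivWithinAt.congr (fun y hy => ?_) ?_
      · rcases eq_or_lt_of_le (mem_Ici.1 hy) with rfl | hy
        · simp [h]
        · exact if_pos hy
      · simp [h]
  · rw [if_pos hx]
    refine (hu x).congr_of_eventuallyEq ?_
    filter_upwards [Ioi_mem_nhds hx] with y hy
    exact if_pos hy

theorem continuous_ite_lt {u v : ℝ → ℝ} {a : ℝ} (hu : Continuous u) (hv : Continuous v)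
    (h : u a = v a) : Continuous (fun y => if a < y then u y else v y) := by
  have := Continuous.if_le hv hu continuous_id (continuous_const (y := a))
    (fun x hx => by rw [show x = a from hx, h])
  refine this.congr fun x => ?_
  by_cases hx : x ≤ a
  · simp [hx, not_lt.2 hx]
  · simp [hx, not_le.1 hx]

theorem hasDerivAt_exp_add_exp_s2 (c k d l a x : ℝ) :
    HasDerivAt (fun y => c * exp (k * (y - a)) + d * exp (l * (y - a)))
      (c * k * exp (k * (x - a)) + d * l * exp (l * (x - a))) x := by
  have key (c k : ℝ) : HasDerivAt (fun y => c * exp (k * (y - a)))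
      (c * k * exp (k * (x - a))) x := by
    have := ((((hasDerivAt_id' x).sub_const a).const_mul k).exp).const_mul c
    exact this.congr_deriv (by ring)
  exact (key c k).add (key d l)

/-- A function given by sums of two exponentials on either side of `a`, with matching values and
slopes at `a`, is continuously differentiable. -/
theorem exists_continuous_hasDerivAt_of_ite_exp {f : ℝ → ℝ} {a c k d l c' k' d' l' : ℝ}
    (hf : ∀ x, f x = if a < x then c * exp (k * (x - a)) + d * exp (l * (x - a))
      else c' * exp (k' * (x - a)) + d' * exp (l' * (x - a)))
    (h : c + d = c' + d') (h' : c * k + d * l = c' * k' + d' * l') :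
    ∃ f' : ℝ → ℝ, Continuous f' ∧ ∀ x, HasDerivAt f (f' x) x := by
  refine ⟨fun x => if a < x then c * k * exp (k * (x - a)) + d * l * exp (l * (x - a))
      else c' * k' * exp (k' * (x - a)) + d' * l' * exp (l' * (x - a)), ?_, fun x => ?_⟩
  · exact continuous_ite_lt (by fun_prop) (by fun_prop) (by simpa using h')
  · rw [funext hf]
    exact hasDerivAt_ite_lt_s2 (fun x => hasDerivAt_exp_add_exp_s2 c k d l a x)
      (fun x => hasDerivAt_exp_add_exp_s2 c' k' d' l' a x) (by simpa using h) (by simpa using h') x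

theorem tendsto_exp_add_exp_atTop {c k d l : ℝ} (a : ℝ) (hc : 0 < c) (hk : 0 < k) (hl : 0 < l) :
    Tendsto (fun x => c * exp (k * (x - a)) + d * exp (-l * (x - a))) atTop atTop := by
  have hlin : Tendsto (fun x : ℝ => x - a) atTop atTop :=
    tendsto_atTop_add_const_right _ (-a) tendsto_id
  refine Tendsto.atTop_add (C := d * 0) ?_ ?_
  · exact (tendsto_exp_atTop.comp (hlin.const_mul_atTop hk)).const_mul_atTop hc
  · exact (tendsto_exp_atBot.comp
      (hlin.const_mul_atTop_of_neg (neg_lt_zero.2 hl))).const_mul d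

theorem sqrt_sq_add_add_div_pos {q σ : ℝ} (μ : ℝ) (hq : 0 < q) (hσ : 0 < σ) :
    0 < (√(μ ^ 2 + 2 * q * σ ^ 2) + μ) / σ ^ 2 ∧ 0 < (√(μ ^ 2 + 2 * q * σ ^ 2) - μ) / σ ^ 2 := by
  have hlt : |μ| < √(μ ^ 2 + 2 * q * σ ^ 2) := by
    rw [← Real.sqrt_sq_eq_abs]
    exact Real.sqrt_lt_sqrt (sq_nonneg μ) (lt_add_of_pos_right _ (by positivity))
  obtain ⟨h₁, h₂⟩ := abs_lt.1 hlt
  exact ⟨div_pos (by linarith) (by positivity), div_pos (by linarith) (by positivity)⟩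

/-- First-order condition for a quotient at a local maximum with nonzero denominator. -/
theorem IsLocalMax.deriv_mul_eq_of_div {u v : ℝ → ℝ} {u' v' x : ℝ}
    (h : IsLocalMax (fun y => u y / v y) x) (hu : HasDerivAt u u' x) (hv : HasDerivAt v v' x)
    (hx : v x ≠ 0) : u' * v x = u x * v' := by
  have h0 := h.hasDerivAt_eq_zero (hu.div hv hx)
  rw [div_eq_zero_iff, or_iff_left (pow_ne_zero 2 hx)] at h0
  linarith

theorem statement2
    (a q μp μm σp σm : ℝ)
    (ha : 0 < a) (hq : 0 < q) (hσp : 0 < σp) (hσm : 0 < σm)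
    (θ1p θ2p θ1m θ2m cm cp : ℝ)
    (hθ1p : θ1p = (Real.sqrt (μp ^ 2 + 2 * q * σp ^ 2) + μp) / σp ^ 2)
    (hθ2p : θ2p = (Real.sqrt (μp ^ 2 + 2 * q * σp ^ 2) - μp) / σp ^ 2)
    (hθ1m : θ1m = (Real.sqrt (μm ^ 2 + 2 * q * σm ^ 2) + μm) / σm ^ 2)
    (hθ2m : θ2m = (Real.sqrt (μm ^ 2 + 2 * q * σm ^ 2) - μm) / σm ^ 2)
    (hcm : cm = (θ1m - θ1p) / (θ2m + θ1m))
    (hcp : cp = (θ2p - θ2m) / (θ2p + θ1p))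
    (gm gp g : ℝ → ℝ)
    (hgm : ∀ x, gm x = if a < x then Real.exp (-θ1p * (x - a))
      else cm * Real.exp (θ2m * (x - a)) + (1 - cm) * Real.exp (-θ1m * (x - a)))
    (hgp : ∀ x, gp x = if a < x then (1 - cp) * Real.exp (θ2p * (x - a)) + cp * Real.exp (-θ1p * (x - a))
      else Real.exp (θ2m * (x - a)))
    (hg : ∀ x, g x = gp x * gm 0 - gm x * gp 0)
    (β : ℝ) (hβ : 0 < β)
    (Dζ : Set (ℝ × ℝ))
    (hD : Dζ = {p : ℝ × ℝ | 0 ≤ p.1 ∧ 0 ≤ p.2 ∧ p.1 + β ≤ p.2})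
    (ζ : ℝ → ℝ → ℝ)
    (hζ : ∀ z₁ z₂, ζ z₁ z₂ = (z₂ - z₁ - β) / (g z₂ - g z₁))
    (Mζ : Set (ℝ × ℝ))
    (hM : Mζ = {p ∈ Dζ | ∀ p' ∈ Dζ, ζ p'.1 p'.2 ≤ ζ p.1 p.2})
    (ψ : ℝ → ℝ → ℝ)
    (hψ : ∀ x y, ψ x y = ∫ s in x..y, (1 - deriv g s / deriv g y))
    :
    ∀ p ∈ Mζ, (g p.2 - g p.1 = (p.2 - p.1 - β) * deriv g p.2 ∧ ψ p.1 p.2 = β) ∧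
      (0 < p.1 → g p.2 - g p.1 = (p.2 - p.1 - β) * deriv g p.1 ∧ deriv g p.1 = deriv g p.2) := by
  obtain ⟨h1p, h2p⟩ := sqrt_sq_add_add_div_pos μp hq hσp
  obtain ⟨h1m, h2m⟩ := sqrt_sq_add_add_div_pos μm hq hσm
  rw [← hθ1p] at h1p
  rw [← hθ2p] at h2p
  rw [← hθ1m] at h1m
  rw [← hθ2m] at h2m
  have hcm' : cm * (θ2m + θ1m) = θ1m - θ1p := by rw [hcm]; field_simp
  have hcp' : cp * (θ2p + θ1p) = θ2p - θ2m := by rw [hcp]; field_simp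
  obtain ⟨gm', hgm'c, hgm'⟩ := exists_continuous_hasDerivAt_of_ite_exp (f := gm) (a := a)
    (c := 1) (k := -θ1p) (d := 0) (l := 0) (c' := cm) (k' := θ2m) (d' := 1 - cm) (l' := -θ1m)
    (fun x => by rw [hgm]; simp) (by ring) (by linarith)
  obtain ⟨gp', hgp'c, hgp'⟩ := exists_continuous_hasDerivAt_of_ite_exp (f := gp) (a := a)
    (c := 1 - cp) (k := θ2p) (d := cp) (l := -θ1p) (c' := 1) (k' := θ2m) (d' := 0) (l' := 0)
    (fun x => by rw [hgp]; simp) (by ring) (by linarith)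
  have hg' (x : ℝ) : HasDerivAt g (gp' x * gm 0 - gm' x * gp 0) x := by
    rw [funext hg]
    exact ((hgp' x).mul_const _).sub ((hgm' x).mul_const _)
  have hderiv : deriv g = fun x => gp' x * gm 0 - gm' x * gp 0 := funext fun x => (hg' x).deriv
  have hgd (x : ℝ) : HasDerivAt g (deriv g x) x := (hg' x).differentiableAt.hasDerivAt
  have hgc : Continuous (deriv g) := by rw [hderiv]; fun_prop
  have hg0 : g 0 = 0 := by rw [hg]; ring
  have hgm0 : 0 < gm 0 := by
    have hcm1 : 0 < 1 - cm := by
      rw [hcm, one_sub_div (by positivity)]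
      exact div_pos (by linarith) (by positivity)
    have hle : exp (θ2m * (0 - a)) ≤ exp (-θ1m * (0 - a)) := exp_le_exp.2 (by nlinarith)
    rw [hgm, if_neg ha.not_gt]
    nlinarith [exp_pos (θ2m * (0 - a)), mul_le_mul_of_nonneg_left hle hcm1.le]
  have hcp1 : 0 < 1 - cp := by
    rw [hcp, one_sub_div (by positivity)]
    exact div_pos (by linarith) (by positivity)
  have hgtop : Tendsto g atTop atTop := by
    refine (tendsto_exp_add_exp_atTop (d := cp * gm 0 - gp 0) a (mul_pos hcp1 hgm0) h2p
      h1p).congr' ?_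
    filter_upwards [eventually_gt_atTop a] with x hx
    rw [hg x, hgp x, hgm x, if_pos hx, if_pos hx]
    ring
  obtain ⟨y, hgy, hy⟩ := ((hgtop.eventually_gt_atTop 0).and (eventually_gt_atTop β)).exists
  rintro ⟨z₁, z₂⟩ hp
  simp only [hM, hD, mem_ofPred_eq, Prod.forall] at hp
  obtain ⟨⟨hz₁, hz₂, hz⟩, hmax⟩ := hp
  have hpos : 0 < ζ z₁ z₂ := by
    refine lt_of_lt_of_le ?_ (hmax 0 y ⟨le_rfl, by linarith, by linarith⟩)
    rw [hζ, hg0]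
    exact div_pos (by linarith) (by linarith)
  rw [hζ] at hpos
  have hden : g z₂ - g z₁ ≠ 0 := fun h => by simp [h] at hpos
  have hz' : z₁ + β < z₂ := by
    refine lt_of_le_of_ne hz fun h => ?_
    simp [← h] at hpos
  have hmax₂ : IsLocalMax (fun y => (y - z₁ - β) / (g y - g z₁)) z₂ := by
    filter_upwards [Ioi_mem_nhds hz'] with y hy
    rw [mem_Ioi] at hy
    simpa only [hζ] using hmax z₁ y ⟨hz₁, by linarith, hy.le⟩
  have hfoc₂ : g z₂ - g z₁ = (z₂ - z₁ - β) * deriv g z₂ := by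
    simpa using hmax₂.deriv_mul_eq_of_div (((hasDerivAt_id z₂).sub_const z₁).sub_const β)
      ((hgd z₂).sub_const (g z₁)) hden
  have hd₂ : deriv g z₂ ≠ 0 := fun h => hden (by rw [hfoc₂, h, mul_zero])
  refine ⟨⟨hfoc₂, ?_⟩, fun hz₁pos => ?_⟩
  · rw [hψ, intervalIntegral.integral_sub intervalIntegrable_const
      ((hgc.div_const _).intervalIntegrable _ _), intervalIntegral.integral_div,
      intervalIntegral.integral_eq_sub_of_hasDerivAt (fun x _ => hgd x)
        (hgc.intervalIntegrable _ _), hfoc₂, mul_div_cancel_right₀ _ hd₂]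
    simp
  · have hmax₁ : IsLocalMax (fun x => (z₂ - x - β) / (g z₂ - g x)) z₁ := by
      filter_upwards [Ioo_mem_nhds hz₁pos (lt_sub_iff_add_lt.2 hz')] with x hx
      simpa only [hζ] using hmax x z₂ ⟨hx.1.le, hz₂, (lt_sub_iff_add_lt.1 hx.2).le⟩
    have hfoc₁ : g z₂ - g z₁ = (z₂ - z₁ - β) * deriv g z₁ := by
      have := hmax₁.deriv_mul_eq_of_div (((hasDerivAt_id z₁).const_sub z₂).sub_const β)
        ((hgd z₁).const_sub (g z₂)) hden
      linarith
    exact ⟨hfoc₁, mul_left_cancel₀ (by linarith) (hfoc₁.symm.trans hfoc₂)⟩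
end

section
/- Assume μ₊ > 0 and μ₋ > 0, and that one of the following holds: (c₊ > 0 and 0 < a₂ ≤ a ≤ a₁), or (c₊ > 0 and 0 < a₃ ≤ a ≤ min(a₁,a₂)), or (c₊ ≤ 0, Θ > 0 and 0 < a₃ ≤ a ≤ a₁). Then g is concave on (0,a) and convex on (a,∞). -/
open Real Set Filter

/-- A combination of two exponentials is convex where its second derivative is nonnegative. -/
theorem convexOn_add_exp {D : Set ℝ} (hD : Convex ℝ D) (hDo : IsOpen D) (A B α β c : ℝ)
    (h : ∀ x ∈ D, 0 ≤ A * α ^ 2 * exp (α * (x - c)) + B * β ^ 2 * exp (β * (x - c))) :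
    ConvexOn ℝ D (fun x ↦ A * exp (α * (x - c)) + B * exp (β * (x - c))) := by
  have key (A B x : ℝ) : HasDerivAt (fun x ↦ A * exp (α * (x - c)) + B * exp (β * (x - c)))
      (A * α * exp (α * (x - c)) + B * β * exp (β * (x - c))) x := by
    have hexp (k : ℝ) : HasDerivAt (fun x ↦ exp (k * (x - c))) (exp (k * (x - c)) * (k * 1)) x :=
      (((hasDerivAt_id x).sub_const c).const_mul k).exp
    refine (((hexp α).const_mul A).add ((hexp β).const_mul B)).congr_deriv ?_
    ring
  refine convexOn_of_hasDerivWithinAt2_nonneg hD (fun x _ ↦ (key A B x).continuousAt.continuousWithinAt)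
    (fun x _ ↦ (key A B x).hasDerivWithinAt) (fun x _ ↦ (key (A * α) (B * β) x).hasDerivWithinAt) ?_
  intro x hx
  rw [hDo.interior_eq] at hx
  convert h x hx using 1
  ring

/-- The roots `(√(μ² + 2qσ²) ± μ) / σ²` are positive, and for `μ > 0` the one with `+` is larger. -/
theorem roots_pos_lt {μ q σ : ℝ} (hq : 0 < q) (hσ : 0 < σ) (hμ : 0 < μ) :
    0 < (√(μ ^ 2 + 2 * q * σ ^ 2) - μ) / σ ^ 2 ∧
      (√(μ ^ 2 + 2 * q * σ ^ 2) - μ) / σ ^ 2 < (√(μ ^ 2 + 2 * q * σ ^ 2) + μ) / σ ^ 2 := by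
  have h : μ < √(μ ^ 2 + 2 * q * σ ^ 2) := Real.lt_sqrt_of_sq_lt (by
    have : 0 < 2 * q * σ ^ 2 := by positivity
    linarith)
  refine ⟨div_pos (by linarith) (by positivity), ?_⟩
  gcongr
  linarith

/-- The exponential form of `log R / s ≤ a`, valid for every real `R`. -/
theorem le_exp_mul_of_log_div_le {R s a : ℝ} (hs : 0 < s) (h : log R / s ≤ a) :
    R ≤ exp (s * a) :=
  (le_exp_log R).trans (exp_le_exp.2 (by rwa [div_le_iff₀' hs] at h))

theorem statement3
    (a q μp μm σp σm : ℝ)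
    (ha : 0 < a) (hq : 0 < q) (hσp : 0 < σp) (hσm : 0 < σm)
    (θ1p θ2p θ1m θ2m cm cp : ℝ)
    (hθ1p : θ1p = (Real.sqrt (μp ^ 2 + 2 * q * σp ^ 2) + μp) / σp ^ 2)
    (hθ2p : θ2p = (Real.sqrt (μp ^ 2 + 2 * q * σp ^ 2) - μp) / σp ^ 2)
    (hθ1m : θ1m = (Real.sqrt (μm ^ 2 + 2 * q * σm ^ 2) + μm) / σm ^ 2)
    (hθ2m : θ2m = (Real.sqrt (μm ^ 2 + 2 * q * σm ^ 2) - μm) / σm ^ 2)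
    (hcm : cm = (θ1m - θ1p) / (θ2m + θ1m))
    (hcp : cp = (θ2p - θ2m) / (θ2p + θ1p))
    (gm gp g : ℝ → ℝ)
    (hgm : ∀ x, gm x = if a < x then Real.exp (-θ1p * (x - a))
      else cm * Real.exp (θ2m * (x - a)) + (1 - cm) * Real.exp (-θ1m * (x - a)))
    (hgp : ∀ x, gp x = if a < x then (1 - cp) * Real.exp (θ2p * (x - a)) + cp * Real.exp (-θ1p * (x - a))
      else Real.exp (θ2m * (x - a)))
    (hg : ∀ x, g x = gp x * gm 0 - gm x * gp 0)
    (hμp : 0 < μp) (hμm : 0 < μm)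
    (Θ : ℝ)
    (hΘ : Θ = cp * θ1p ^ 2 + (1 - cp) * θ2p ^ 2)
    (a₁ : ℝ)
    (ha₁ : a₁ = 2 * Real.log (θ1m / θ2m) / (θ2m + θ1m))
    (a₂ : ℝ)
    (ha₂ : a₂ = Real.log ((θ2p + θ1m) / (θ2p - θ2m)) / (θ1m + θ2m))
    (a₃ : ℝ)
    (ha₃ : a₃ = Real.log (((1 - cm * cp) * θ1p ^ 2 - (1 - cp) * cm * θ2p ^ 2) / ((1 - cm) * Θ)) / (θ1m + θ2m))
    (hcase : (0 < cp ∧ 0 < a₂ ∧ a₂ ≤ a ∧ a ≤ a₁) ∨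
      (0 < cp ∧ 0 < a₃ ∧ a₃ ≤ a ∧ a ≤ min a₁ a₂) ∨
      (cp ≤ 0 ∧ 0 < Θ ∧ 0 < a₃ ∧ a₃ ≤ a ∧ a ≤ a₁))
    :
    ConcaveOn ℝ (Set.Ioo 0 a) g ∧ ConvexOn ℝ (Set.Ioi a) g := by
  obtain ⟨hQ, hPQ⟩ := roots_pos_lt hq hσp hμp
  obtain ⟨hm, hpm⟩ := roots_pos_lt hq hσm hμm
  rw [← hθ2p] at hQ hPQ
  rw [← hθ2m] at hm hpm
  rw [← hθ1p] at hPQ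
  rw [← hθ1m] at hpm
  have hP : 0 < θ1p := hQ.trans hPQ
  have hp : 0 < θ1m := hm.trans hpm
  have hs : 0 < θ1m + θ2m := by positivity
  have hcm1 : 1 - cm = (θ2m + θ1p) / (θ2m + θ1m) := by rw [hcm]; field_simp; ring
  have hcp1 : 1 - cp = (θ1p + θ2m) / (θ2p + θ1p) := by rw [hcp]; field_simp; ring
  have hcm0 : 0 < 1 - cm := by rw [hcm1]; positivity
  have hcp0 : 0 < 1 - cp := by rw [hcp1]; positivity
  set F := exp (-(θ2m * a)) with hF
  set T := exp ((θ1m + θ2m) * a) with hT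
  have hF0 : 0 < F := exp_pos _
  have hgp0 : gp 0 = F := by
    rw [hgp, if_neg ha.not_gt, hF]; ring_nf
  have hFT : exp (θ1m * a) = F * T := by
    rw [hF, hT, ← exp_add]; ring_nf
  have hgm0 : gm 0 = F * (cm + (1 - cm) * T) := by
    have h1 : exp (θ2m * (0 - a)) = F := by rw [hF]; ring_nf
    have h2 : exp (-θ1m * (0 - a)) = F * T := by rw [← hFT]; ring_nf
    rw [hgm, if_neg ha.not_gt, h1, h2]; ring
  have hT1 : 1 < T := one_lt_exp_iff.2 (by positivity)
  have hG0 : 0 < gm 0 := by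
    rw [hgm0]
    have := mul_pos hcm0 (sub_pos.2 hT1)
    exact mul_pos hF0 (by linarith)
  have haa₁ : a ≤ a₁ := by
    rcases hcase with h | h | h
    · exact h.2.2.2
    · exact h.2.2.2.trans (min_le_left _ _)
    · exact h.2.2.2.2
  have hcond : 0 ≤ cp * gm 0 - F ∨ 0 ≤ (1 - cp) * gm 0 * θ2p ^ 2 + (cp * gm 0 - F) * θ1p ^ 2 := by
    have of_a₃ (hΘ0 : 0 < Θ) (h : a₃ ≤ a) :
        0 ≤ (1 - cp) * gm 0 * θ2p ^ 2 + (cp * gm 0 - F) * θ1p ^ 2 := by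
      rw [ha₃] at h
      have h' := le_exp_mul_of_log_div_le hs h
      rw [← hT, div_le_iff₀ (mul_pos hcm0 hΘ0), hΘ] at h'
      have := mul_le_mul_of_nonneg_left h' hF0.le
      rw [hgm0]
      linarith
    rcases hcase with h | h | h
    · left
      have hQm : 0 < θ2p - θ2m := by
        have h0 := h.1
        rw [hcp] at h0
        exact (div_pos_iff_of_pos_right (by positivity)).1 h0
      have h' := h.2.2.1
      rw [ha₂] at h'
      have h'' := le_exp_mul_of_log_div_le hs h'
      rw [← hT, div_le_iff₀ hQm] at h''
      have e : cp * gm 0 - F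
          = F * ((θ2m + θ1p) / ((θ2p + θ1p) * (θ2m + θ1m)) * (T * (θ2p - θ2m) - (θ2p + θ1m))) := by
        rw [hgm0, hcm1, hcm, hcp]
        field_simp
        ring
      rw [e]
      exact mul_nonneg hF0.le (mul_nonneg (by positivity) (by linarith))
    · refine .inr (of_a₃ ?_ h.2.2.1)
      have := h.1
      rw [hΘ]
      positivity
    · exact .inr (of_a₃ h.2.1 h.2.2.2.1)
  constructor
  · rw [← neg_convexOn_iff]
    refine (convexOn_add_exp (convex_Ioo 0 a) isOpen_Ioo (-((1 - cm) * (F * T))) ((1 - cm) * F)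
      θ2m (-θ1m) a ?_).congr ?_
    · intro x hx
      have h1 : (θ2m + θ1m) * x ≤ 2 * log (θ1m / θ2m) := by
        rw [ha₁, le_div_iff₀' (by positivity)] at haa₁
        exact (mul_le_mul_of_nonneg_left hx.2.le (by positivity)).trans haa₁
      have h2 : exp ((θ2m + θ1m) * x) * θ2m ^ 2 ≤ θ1m ^ 2 := by
        have h3 := exp_le_exp.2 h1
        have h4 : exp (2 * log (θ1m / θ2m)) = (θ1m / θ2m) ^ 2 := by
          rw [two_mul, exp_add, exp_log (by positivity), sq]
        rw [h4, div_pow, le_div_iff₀ (by positivity)] at h3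
        exact h3
      have h5 : T * exp (θ2m * (x - a)) = exp ((θ2m + θ1m) * x) * exp (-θ1m * (x - a)) := by
        rw [hT, ← exp_add, ← exp_add]; ring_nf
      have h6 : -((1 - cm) * (F * T)) * θ2m ^ 2 * exp (θ2m * (x - a)) +
          (1 - cm) * F * (-θ1m) ^ 2 * exp (-θ1m * (x - a)) =
          (1 - cm) * F * exp (-θ1m * (x - a)) * (θ1m ^ 2 - exp ((θ2m + θ1m) * x) * θ2m ^ 2) := by
        linear_combination (-((1 - cm) * F * θ2m ^ 2)) * h5
      rw [h6]
      exact mul_nonneg (by positivity) (by linarith)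
    · intro x hx
      simp only [Pi.neg_apply, hg, hgp0, hgm0]
      rw [hgp x, hgm x, if_neg hx.2.le.not_gt, if_neg hx.2.le.not_gt]
      ring
  · refine (convexOn_add_exp (convex_Ioi a) isOpen_Ioi ((1 - cp) * gm 0) (cp * gm 0 - F)
      θ2p (-θ1p) a ?_).congr ?_
    · intro x hx
      have hx : 0 < x - a := sub_pos.2 hx
      by_cases hc : 0 ≤ cp * gm 0 - F
      · positivity
      · have hcond := hcond.resolve_left hc
        have h1 : 1 ≤ exp (θ2p * (x - a)) := one_le_exp (by positivity)
        have h2 : exp (-θ1p * (x - a)) ≤ 1 := exp_le_one_iff.2 (by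
          have := mul_pos hP hx
          linarith)
        have h3 : (1 - cp) * gm 0 * θ2p ^ 2 * 1
            ≤ (1 - cp) * gm 0 * θ2p ^ 2 * exp (θ2p * (x - a)) := by gcongr
        have h4 : (cp * gm 0 - F) * (-θ1p) ^ 2 * 1
            ≤ (cp * gm 0 - F) * (-θ1p) ^ 2 * exp (-θ1p * (x - a)) :=
          mul_le_mul_of_nonpos_left h2
            (mul_nonpos_of_nonpos_of_nonneg (not_le.1 hc).le (sq_nonneg _))
        linarith
    · intro x hx
      have hx : a < x := hx
      simp only [hg x, hgp0]
      rw [hgp x, hgm x, if_pos hx, if_pos hx]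
      ring
end
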